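/- Let 1 ≤ p ≤ 2, let l ∈ ℕ and M = 2^l, and let ν_1, …, ν_M ∈ ℝ^M be pairwise orthogonal vectors all of whose coordinates are ±1. For any sign vector s ∈ {−1,+1}^M define x* := −M^{−(1/p + 1/2)} · Σ_{i=1}^M s_i ν_i. Then ⟨ν_i, x*⟩ / M^{1−1/p} = −s_i · M^{−1/2} for every i ∈ {1,…,M}, and ‖x*‖_p ≤ 1. -/

import Mathlib

/-- The `L^p` norm on `ℝ^n` (for real `p`). -/
noncomputable def pNorm {n : ℕ} (p : ℝ) (x : Fin n → ℝ) : ℝ :=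
  (∑ i, |x i| ^ p) ^ (1 / p)

/-- for `1 ≤ p ≤ 2`, `M = 2^l`, pairwise orthogonal `±1`-vectors
`ν_i` and a sign vector `s`, the point `x* = -M^{-(1/p+1/2)} Σ_i s_i ν_i`
satisfies `⟨ν_i, x*⟩ / M^{1-1/p} = -s_i M^{-1/2}` for every `i`, and
`‖x*‖_p ≤ 1`. -/
theorem scaled_sign_combination_in_ball (p : ℝ) (hp1 : 1 ≤ p) (hp2 : p ≤ 2)
    (l : ℕ) (M : ℕ) (hM : M = 2 ^ l)
    (ν : Fin M → Fin M → ℝ)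
    (hν1 : ∀ i k, ν i k = 1 ∨ ν i k = -1)
    (hν2 : ∀ i j, i ≠ j → ∑ k, ν i k * ν j k = 0)
    (s : Fin M → ℝ) (hs : ∀ i, s i = 1 ∨ s i = -1)
    (xstar : Fin M → ℝ)
    (hx : ∀ k, xstar k = -((M : ℝ) ^ (-(1 / p + 1 / 2))) * ∑ i, s i * ν i k) :
    (∀ i, (∑ k, ν i k * xstar k) / (M : ℝ) ^ (1 - 1 / p) =
      -(s i) * (M : ℝ) ^ (-(1 / 2) : ℝ)) ∧
    pNorm p xstar ≤ 1 := by
  have hM0 : (0 : ℝ) < M := by rw [hM]; positivity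
  have hp0 : 0 < p := by linarith
  have hsq : ∀ i, ∑ k, ν i k * ν i k = (M : ℝ) := by
    intro i
    have h : ∀ k, ν i k * ν i k = 1 := by
      intro k
      rcases hν1 i k with h | h <;> rw [h] <;> norm_num
    simp [h]
  have hS : ∀ i, ∑ k, ν i k * ∑ j, s j * ν j k = s i * (M : ℝ) := by
    intro i
    have h1 : ∑ k, ν i k * ∑ j, s j * ν j k = ∑ j, s j * ∑ k, ν i k * ν j k := by
      simp_rw [Finset.mul_sum]
      rw [Finset.sum_comm]
      refine Finset.sum_congr rfl fun j _ => Finset.sum_congr rfl fun k _ => by ring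
    rw [h1, Finset.sum_eq_single i, hsq]
    · intro j _ hj
      rw [hν2 i j (Ne.symm hj), mul_zero]
    · simp
  have hSS : ∑ k, (∑ j, s j * ν j k) ^ 2 = (M : ℝ) * M := by
    have h1 : ∑ k, (∑ j, s j * ν j k) ^ 2 = ∑ i, s i * ∑ k, ν i k * ∑ j, s j * ν j k := by
      have h0 : ∀ i, s i * ∑ k, ν i k * ∑ j, s j * ν j k
          = ∑ k, s i * (ν i k * ∑ j, s j * ν j k) := fun i => Finset.mul_sum _ _ _
      rw [Finset.sum_congr rfl fun i _ => h0 i, Finset.sum_comm]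
      refine Finset.sum_congr rfl fun k _ => ?_
      rw [sq, Finset.sum_mul]
      refine Finset.sum_congr rfl fun i _ => by ring
    rw [h1]
    have h2 : ∀ i, s i * (s i * (M : ℝ)) = M := by
      intro i
      rcases hs i with h | h <;> rw [h] <;> ring
    simp [hS, h2]
  constructor
  · intro i
    have h1 : ∑ k, ν i k * xstar k = -((M : ℝ) ^ (-(1 / p + 1 / 2))) * (s i * M) := by
      rw [← hS i, Finset.mul_sum]
      refine Finset.sum_congr rfl fun k _ => by rw [hx]; ring
    rw [h1, div_eq_iff (Real.rpow_pos_of_pos hM0 _).ne']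
    have h2 : (M : ℝ) ^ (-(1 / p + 1 / 2)) * M
        = (M : ℝ) ^ (-(1 / 2) : ℝ) * (M : ℝ) ^ (1 - 1 / p) := by
      rw [← Real.rpow_add hM0, ← Real.rpow_add_one hM0.ne']
      congr 1
      ring
    linear_combination (-(s i)) * h2
  · unfold pNorm
    refine Real.rpow_le_one (Finset.sum_nonneg fun k _ => by positivity) ?_ (by positivity)
    have key : ∀ k, |xstar k| ^ p ≤
        (M : ℝ)⁻¹ * (1 + p / 2 * ((∑ j, s j * ν j k) ^ 2 / M - 1)) := by
      intro k
      have hsqx : |xstar k| ^ (2 : ℝ)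
          = (M : ℝ) ^ (-(2 / p)) * ((∑ j, s j * ν j k) ^ 2 / M) := by
        have h3 : ((M : ℝ) ^ (-(1 / p + 1 / 2))) ^ 2 = (M : ℝ) ^ (-(2 / p)) / M := by
          rw [← Real.rpow_natCast, ← Real.rpow_mul hM0.le, ← Real.rpow_sub_one hM0.ne']
          congr 1
          push_cast
          ring
        rw [Real.rpow_two, sq_abs, hx, mul_pow, neg_sq, h3]
        ring
      have h4 : |xstar k| ^ p = (|xstar k| ^ (2 : ℝ)) ^ (p / 2) := by
        rw [← Real.rpow_mul (abs_nonneg _)]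
        congr 1
        ring
      have h5 : ((M : ℝ) ^ (-(2 / p))) ^ (p / 2) = (M : ℝ)⁻¹ := by
        rw [← Real.rpow_mul hM0.le, ← Real.rpow_neg_one]
        congr 1
        field_simp
      rw [h4, hsqx, Real.mul_rpow (by positivity) (by positivity), h5]
      refine mul_le_mul_of_nonneg_left ?_ (by positivity)
      have ht : 0 ≤ (∑ j, s j * ν j k) ^ 2 / (M : ℝ) := by positivity
      have := rpow_one_add_le_one_add_mul_self
        (s := (∑ j, s j * ν j k) ^ 2 / (M : ℝ) - 1) (by linarith)
        (p := p / 2) (by linarith) (by linarith)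
      rwa [add_sub_cancel] at this
    refine (Finset.sum_le_sum fun k _ => key k).trans (le_of_eq ?_)
    rw [← Finset.mul_sum, Finset.sum_add_distrib, ← Finset.mul_sum, Finset.sum_sub_distrib,
      ← Finset.sum_div, hSS]
    simp
    field_simp
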